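/- arXiv:1105.1505 — 2 statements merged into one kernel-verified Lean document; each statement's English description precedes it below -/
import Mathlib

section
/- Continuity of the conditional mutual information rate under total variation: Fix a pmf q(x¹,x²,y¹,y²) on 𝒳¹×𝒳²×𝒴¹×𝒴², let 0 < ε ≤ 1/2, and let P be a pmf on (𝒳¹×𝒳²×𝒴¹×𝒴²)ⁿ with ‖P − q^{⊗n}‖₁ ≤ ε. Writing (X¹_{1:n}, X²_{1:n}, Y¹_{1:n}, Y²_{1:n}) ∼ P, we have (1/n)·I_P(Y¹_{1:n}; Y²_{1:n} | X¹_{1:n}, X²_{1:n}) ≥ I_q(Y¹; Y² | X¹, X²) − 3κ(ε), where κ(ε) = −ε·log(ε / (|𝒳¹||𝒳²||𝒴¹||𝒴²|)). -/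
open scoped BigOperators
open Finset

noncomputable section

namespace Coord

variable {Ω α β γ : Type*}

/-- `p` is a probability mass function on the finite type `α`. -/
def IsPMF [Fintype α] (p : α → ℝ) : Prop := (∀ a, 0 ≤ p a) ∧ ∑ a, p a = 1

/-- ℓ¹ (total variation) distance between two functions on a finite type. -/
def l1dist [Fintype α] (p q : α → ℝ) : ℝ := ∑ a, |p a - q a|

/-- The distribution (pushforward pmf) of the random variable `X` defined on the
finite sample space `Ω` carrying the pmf `μ`. -/
def distr [Fintype Ω] [DecidableEq α] (μ : Ω → ℝ) (X : Ω → α) : α → ℝ :=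
  fun a => ∑ ω, if X ω = a then μ ω else 0

/-- Shannon entropy (base 2) of a pmf. -/
def entFun [Fintype α] (p : α → ℝ) : ℝ := - ∑ a, p a * Real.logb 2 (p a)

/-- Shannon entropy `H(X)` of a random variable `X` on `(Ω, μ)`. -/
def H [Fintype Ω] [Fintype α] [DecidableEq α] (μ : Ω → ℝ) (X : Ω → α) : ℝ :=
  entFun (distr μ X)

/-- Conditional entropy `H(X | Z)`. -/
def condEnt [Fintype Ω] [Fintype α] [Fintype γ] [DecidableEq α] [DecidableEq γ]
    (μ : Ω → ℝ) (X : Ω → α) (Z : Ω → γ) : ℝ :=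
  H μ (fun ω => (X ω, Z ω)) - H μ Z

/-- Mutual information `I(X; Y)`. -/
def mi [Fintype Ω] [Fintype α] [Fintype β] [DecidableEq α] [DecidableEq β]
    (μ : Ω → ℝ) (X : Ω → α) (Y : Ω → β) : ℝ :=
  H μ X + H μ Y - H μ (fun ω => (X ω, Y ω))

/-- Conditional mutual information `I(X; Y | Z)`. -/
def cmi [Fintype Ω] [Fintype α] [Fintype β] [Fintype γ]
    [DecidableEq α] [DecidableEq β] [DecidableEq γ]
    (μ : Ω → ℝ) (X : Ω → α) (Y : Ω → β) (Z : Ω → γ) : ℝ :=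
  H μ (fun ω => (X ω, Z ω)) + H μ (fun ω => (Y ω, Z ω))
    - H μ (fun ω => (X ω, Y ω, Z ω)) - H μ Z

/-- The function `x ↦ x log₂ x`. -/
def mulLogb (x : ℝ) : ℝ := x * Real.logb 2 x

@[simp]
lemma mulLogb_zero : mulLogb 0 = 0 := by simp [mulLogb]

@[simp]
lemma mulLogb_one : mulLogb 1 = 0 := by simp [mulLogb]

lemma entFun_eq [Fintype α] (p : α → ℝ) : entFun p = -∑ a, mulLogb (p a) := rfl

/-- The log sum inequality. -/
lemma log_sum_inequality {ι : Type*} (s : Finset ι) (x w : ι → ℝ)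
    (hx : ∀ i ∈ s, 0 ≤ x i) (hw : ∀ i ∈ s, 0 ≤ w i) (hxw : ∀ i ∈ s, w i = 0 → x i = 0) :
    mulLogb (∑ i ∈ s, x i) - (∑ i ∈ s, x i) * Real.logb 2 (∑ i ∈ s, w i) ≤
      ∑ i ∈ s, (mulLogb (x i) - x i * Real.logb 2 (w i)) := by
  have hlog2 : 0 < Real.log 2 := Real.log_pos one_lt_two
  set X := ∑ i ∈ s, x i with hX
  set W := ∑ i ∈ s, w i with hW
  have key : ∀ i ∈ s, x i * Real.log X - x i * Real.log W + (x i - w i * (X / W)) ≤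
      x i * Real.log (x i) - x i * Real.log (w i) := by
    intro i hi
    have hX0 : 0 ≤ X := sum_nonneg hx
    have hW0 : 0 ≤ W := sum_nonneg hw
    rcases (hx i hi).eq_or_lt with h | h
    · have : 0 ≤ w i * (X / W) := mul_nonneg (hw i hi) (div_nonneg hX0 hW0)
      simp only [← h, zero_mul]
      linarith
    · have hwi : 0 < w i := lt_of_le_of_ne (hw i hi) fun h0 => h.ne' (hxw i hi h0.symm)
      have hXp : 0 < X := h.trans_le (single_le_sum hx hi)
      have hWp : 0 < W := hwi.trans_le (single_le_sum hw hi)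
      have h1 := Real.log_le_sub_one_of_pos (show 0 < (w i * X) / (x i * W) by positivity)
      rw [Real.log_div (by positivity) (by positivity), Real.log_mul hwi.ne' hXp.ne',
        Real.log_mul h.ne' hWp.ne'] at h1
      have h2 := mul_le_mul_of_nonneg_left h1 h.le
      have h3 : x i * ((w i * X) / (x i * W) - 1) = w i * (X / W) - x i := by
        field_simp
      rw [h3] at h2
      linarith
  have hsum := sum_le_sum key
  have hcancel : ∑ i ∈ s, (x i - w i * (X / W)) = 0 := by
    rw [sum_sub_distrib, ← sum_mul, ← hX, ← hW]
    rcases eq_or_ne W 0 with h0 | h0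
    · have : X = 0 := sum_eq_zero fun i hi =>
        hxw i hi ((sum_eq_zero_iff_of_nonneg hw).1 h0 i hi)
      simp [this]
    · field_simp
      ring
  rw [sum_add_distrib, hcancel, add_zero, sum_sub_distrib, ← sum_mul, ← sum_mul, ← hX] at hsum
  have hdiv := div_le_div_of_nonneg_right hsum hlog2.le
  refine (le_of_eq ?_).trans (hdiv.trans (le_of_eq ?_))
  · simp only [mulLogb, Real.logb]
    ring
  · rw [sum_div]
    refine sum_congr rfl fun i _ => ?_
    simp only [mulLogb, Real.logb]
    ring

/-- The defect of additivity of `x ↦ x log₂ x`. -/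
def mixGap (x y : ℝ) : ℝ := mulLogb (x + y) - mulLogb x - mulLogb y

lemma mixGap_nonneg {x y : ℝ} (hx : 0 ≤ x) (hy : 0 ≤ y) : 0 ≤ mixGap x y := by
  have mono : ∀ {a b : ℝ}, 0 ≤ a → 0 ≤ b → a * Real.logb 2 a ≤ a * Real.logb 2 (a + b) := by
    intro a b ha hb
    rcases ha.eq_or_lt with h | h
    · simp [← h]
    · exact mul_le_mul_of_nonneg_left
        (Real.logb_le_logb_of_le one_lt_two h (by linarith)) ha
  have h1 := mono hx hy
  have h2 := mono hy hx
  rw [add_comm y x] at h2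
  simp only [mixGap, mulLogb]
  linarith

lemma mixGap_zero_left (y : ℝ) : mixGap 0 y = 0 := by simp [mixGap]

lemma sum_mixGap_le {ι : Type*} (s : Finset ι) (x y : ι → ℝ)
    (hx : ∀ i ∈ s, 0 ≤ x i) (hy : ∀ i ∈ s, 0 ≤ y i) :
    ∑ i ∈ s, mixGap (x i) (y i) ≤ mixGap (∑ i ∈ s, x i) (∑ i ∈ s, y i) := by
  have h1 := log_sum_inequality s x (fun i => x i + y i) hx
    (fun i hi => add_nonneg (hx i hi) (hy i hi))
    (fun i hi h => by linarith [hx i hi, hy i hi])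
  have h2 := log_sum_inequality s y (fun i => x i + y i) hy
    (fun i hi => add_nonneg (hx i hi) (hy i hi))
    (fun i hi h => by linarith [hx i hi, hy i hi])
  have h3 : ∑ i ∈ s, mixGap (x i) (y i) =
      -(∑ i ∈ s, (mulLogb (x i) - x i * Real.logb 2 (x i + y i)) +
        ∑ i ∈ s, (mulLogb (y i) - y i * Real.logb 2 (x i + y i))) := by
    rw [← sum_add_distrib, ← sum_neg_distrib]
    refine sum_congr rfl fun i _ => ?_
    simp only [mixGap, mulLogb]
    ring
  have h4 : mixGap (∑ i ∈ s, x i) (∑ i ∈ s, y i) =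
      -((mulLogb (∑ i ∈ s, x i) - (∑ i ∈ s, x i) * Real.logb 2 (∑ i ∈ s, (x i + y i))) +
        (mulLogb (∑ i ∈ s, y i) - (∑ i ∈ s, y i) * Real.logb 2 (∑ i ∈ s, (x i + y i)))) := by
    rw [sum_add_distrib]
    simp only [mixGap, mulLogb]
    ring
  rw [h3, h4]
  linarith

lemma mixGap_mono_right {x y z : ℝ} (hx : 0 ≤ x) (hy : 0 ≤ y) (hyz : y ≤ z) :
    mixGap x y ≤ mixGap x z := by
  have h := sum_mixGap_le (univ : Finset (Fin 2)) ![x, 0] ![y, z - y]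
    (by simp [Fin.forall_fin_two, hx]) (by simp [Fin.forall_fin_two, hy, hyz])
  simpa [Fin.sum_univ_two, mixGap_zero_left] using h

/-- Conditional entropy of the first coordinate given the second one, for a nonnegative
function that need not be normalized. -/
def condEntFun [Fintype α] [Fintype γ] (p : α × γ → ℝ) : ℝ :=
  ∑ c, (mulLogb (∑ a, p (a, c)) - ∑ a, mulLogb (p (a, c)))

section condEntFun

variable [Fintype α] [Fintype γ]

lemma condEntFun_nonneg {p : α × γ → ℝ} (hp : ∀ i, 0 ≤ p i) : 0 ≤ condEntFun p := by
  refine sum_nonneg fun c _ => ?_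
  have h : ∀ a, mulLogb (p (a, c)) ≤ p (a, c) * Real.logb 2 (∑ a, p (a, c)) := by
    intro a
    rcases (hp (a, c)).eq_or_lt with h | h
    · simp [← h]
    · exact mul_le_mul_of_nonneg_left (Real.logb_le_logb_of_le one_lt_two h
        (single_le_sum (f := fun a => p (a, c)) (fun a _ => hp (a, c)) (mem_univ a))) h.le
  have := sum_le_sum fun a (_ : a ∈ univ) => h a
  rw [← sum_mul] at this
  exact sub_nonneg.2 this

lemma condEntFun_le {p : α × γ → ℝ} (hp : ∀ i, 0 ≤ p i) :
    condEntFun p ≤ (∑ i, p i) * Real.logb 2 (Fintype.card α) := by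
  rw [Fintype.sum_prod_type_right, sum_mul]
  refine sum_le_sum fun c _ => ?_
  have h := log_sum_inequality univ (fun a => p (a, c)) (fun _ => 1) (fun a _ => hp _)
    (fun _ _ => zero_le_one) (fun _ _ h => absurd h one_ne_zero)
  simp only [Real.logb_one, mul_zero, sub_zero, sum_const, card_univ, nsmul_eq_mul,
    mul_one] at h
  linarith

lemma condEntFun_add_sub (p r : α × γ → ℝ) :
    condEntFun (p + r) - condEntFun p - condEntFun r =
      ∑ c, (mixGap (∑ a, p (a, c)) (∑ a, r (a, c)) - ∑ a, mixGap (p (a, c)) (r (a, c))) := by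
  simp only [condEntFun, ← sum_sub_distrib]
  refine sum_congr rfl fun c _ => ?_
  simp only [mixGap, sum_sub_distrib, Pi.add_apply, sum_add_distrib]
  ring

lemma condEntFun_superadditive {p r : α × γ → ℝ} (hp : ∀ i, 0 ≤ p i) (hr : ∀ i, 0 ≤ r i) :
    condEntFun p + condEntFun r ≤ condEntFun (p + r) := by
  have h : 0 ≤ condEntFun (p + r) - condEntFun p - condEntFun r := by
    rw [condEntFun_add_sub]
    exact sum_nonneg fun c _ => sub_nonneg.2
      (sum_mixGap_le univ _ _ (fun a _ => hp _) (fun a _ => hr _))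
  linarith

lemma condEntFun_add_le {p r : α × γ → ℝ} (hp : ∀ i, 0 ≤ p i) (hr : ∀ i, 0 ≤ r i) :
    condEntFun (p + r) ≤ condEntFun p + condEntFun r + mixGap (∑ i, p i) (∑ i, r i) := by
  have h : condEntFun (p + r) - condEntFun p - condEntFun r ≤
      mixGap (∑ i, p i) (∑ i, r i) := by
    rw [condEntFun_add_sub, Fintype.sum_prod_type_right p, Fintype.sum_prod_type_right r]
    refine (sum_le_sum fun c _ => ?_).trans (sum_mixGap_le univ _ _
      (fun c _ => sum_nonneg fun a _ => hp (a, c)) (fun c _ => sum_nonneg fun a _ => hr (a, c)))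
    exact sub_le_self _ (sum_nonneg fun a _ => mixGap_nonneg (hp _) (hr _))
  linarith

end condEntFun

section distr

variable [Fintype Ω] [DecidableEq α] [DecidableEq γ]

lemma distr_nonneg {μ : Ω → ℝ} (hμ : ∀ ω, 0 ≤ μ ω) (X : Ω → α) (a : α) :
    0 ≤ distr μ X a :=
  sum_nonneg fun ω _ => by split_ifs <;> simp [hμ ω]

lemma distr_add (μ ν : Ω → ℝ) (X : Ω → α) : distr (μ + ν) X = distr μ X + distr ν X := by
  funext a
  simp only [distr, Pi.add_apply, ← sum_add_distrib]
  exact sum_congr rfl fun ω _ => by split_ifs <;> simp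

lemma sum_distr [Fintype α] (μ : Ω → ℝ) (X : Ω → α) : ∑ a, distr μ X a = ∑ ω, μ ω := by
  simp only [distr]
  rw [sum_comm]
  simp

lemma isPMF_distr [Fintype α] {μ : Ω → ℝ} (hμ : IsPMF μ) (X : Ω → α) : IsPMF (distr μ X) :=
  ⟨distr_nonneg hμ.1 X, by rw [sum_distr, hμ.2]⟩

lemma sum_distr_pair [Fintype α] (μ : Ω → ℝ) (X : Ω → α) (Z : Ω → γ) (c : γ) :
    ∑ a, distr μ (fun ω => (X ω, Z ω)) (a, c) = distr μ Z c := by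
  simp only [distr, Prod.mk.injEq, ite_and]
  rw [sum_comm]
  simp

lemma condEnt_eq_condEntFun [Fintype α] [Fintype γ] (μ : Ω → ℝ) (X : Ω → α) (Z : Ω → γ) :
    condEnt μ X Z = condEntFun (distr μ (fun ω => (X ω, Z ω))) := by
  simp only [condEnt, H, entFun_eq, condEntFun, sum_sub_distrib, sum_distr_pair]
  rw [Fintype.sum_prod_type_right]
  ring

/-- Continuity of conditional entropy in total variation, with a bound that does not involve
the alphabet of the conditioning variable. -/
lemma condEnt_le_condEnt_add [Fintype α] [Fintype γ] {μ ν : Ω → ℝ} (hμ : IsPMF μ)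
    (hν : IsPMF ν) {ε : ℝ} (h : l1dist μ ν ≤ ε) (X : Ω → α) (Z : Ω → γ) :
    condEnt μ X Z ≤ condEnt ν X Z + ε / 2 * Real.logb 2 (Fintype.card α) +
      mixGap 1 (ε / 2) := by
  set u : Ω → ℝ := fun ω => max (μ ω - ν ω) 0 with hu
  set v : Ω → ℝ := fun ω => max (ν ω - μ ω) 0 with hv
  have hu0 : ∀ ω, 0 ≤ u ω := fun ω => le_max_right _ _
  have hv0 : ∀ ω, 0 ≤ v ω := fun ω => le_max_right _ _
  have huv : ν + u = μ + v := by
    funext ω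
    simp only [hu, hv, Pi.add_apply]
    rcases le_total (μ ω) (ν ω) with h | h
    · rw [max_eq_right (by linarith), max_eq_left (by linarith)]; ring
    · rw [max_eq_left (by linarith), max_eq_right (by linarith)]; ring
  have hsum : ∑ ω, u ω = ∑ ω, v ω := by
    have := congrArg (fun f => ∑ ω, f ω) huv
    simp only [Pi.add_apply, sum_add_distrib, hμ.2, hν.2] at this
    linarith
  have hl1 : l1dist μ ν = ∑ ω, u ω + ∑ ω, v ω := by
    rw [l1dist, ← sum_add_distrib]
    refine sum_congr rfl fun ω _ => ?_
    simp only [hu, hv]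
    rcases le_total (μ ω) (ν ω) with h | h
    · rw [max_eq_right (by linarith), max_eq_left (by linarith), abs_of_nonpos (by linarith)]
      ring
    · rw [max_eq_left (by linarith), max_eq_right (by linarith), abs_of_nonneg (by linarith)]
      ring
  have huε : ∑ ω, u ω ≤ ε / 2 := by linarith
  set W : Ω → α × γ := fun ω => (X ω, Z ω)
  have h1 := condEntFun_superadditive (distr_nonneg hμ.1 W) (distr_nonneg hv0 W)
  have h2 := condEntFun_nonneg (distr_nonneg hv0 W)
  have h3 := condEntFun_add_le (distr_nonneg hν.1 W) (distr_nonneg hu0 W)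
  have h4 := condEntFun_le (distr_nonneg hu0 W)
  rw [← distr_add, ← huv, distr_add] at h1
  rw [sum_distr, sum_distr, hν.2] at h3
  rw [sum_distr] at h4
  have h5 : (∑ ω, u ω) * Real.logb 2 (Fintype.card α) ≤
      ε / 2 * Real.logb 2 (Fintype.card α) := by
    refine mul_le_mul_of_nonneg_right huε ?_
    simp only [Real.logb]
    exact div_nonneg (Real.log_natCast_nonneg _) (Real.log_pos one_lt_two).le
  have h6 := mixGap_mono_right zero_le_one (sum_nonneg fun ω _ => hu0 ω) huε
  rw [condEnt_eq_condEntFun, condEnt_eq_condEntFun]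
  linarith

lemma condEnt_eq_zero_of_card_eq_one [Fintype α] [Fintype γ] {μ : Ω → ℝ}
    (hμ : ∀ ω, 0 ≤ μ ω) (hα : Fintype.card α = 1) (X : Ω → α) (Z : Ω → γ) :
    condEnt μ X Z = 0 := by
  rw [condEnt_eq_condEntFun]
  refine le_antisymm ?_ (condEntFun_nonneg (distr_nonneg hμ _))
  simpa [hα] using condEntFun_le (distr_nonneg hμ fun ω => (X ω, Z ω))

lemma distr_equiv_comp [DecidableEq β] (μ : Ω → ℝ) (X : Ω → α) (e : α ≃ β) (b : β) :
    distr μ (fun ω => e (X ω)) b = distr μ X (e.symm b) := by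
  simp only [distr, ← Equiv.eq_symm_apply]

lemma H_equiv_comp [Fintype α] [Fintype β] [DecidableEq β] (μ : Ω → ℝ) (X : Ω → α)
    (e : α ≃ β) : H μ (fun ω => e (X ω)) = H μ X := by
  simp only [H, entFun_eq, distr_equiv_comp]
  rw [Equiv.sum_comp e.symm fun a => mulLogb (distr μ X a)]

end distr

lemma cmi_eq_condEnt_sub [Fintype Ω] [Fintype α] [Fintype β] [Fintype γ]
    [DecidableEq α] [DecidableEq β] [DecidableEq γ]
    (μ : Ω → ℝ) (X : Ω → α) (Y : Ω → β) (Z : Ω → γ) :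
    cmi μ X Y Z = condEnt μ X Z - condEnt μ X (fun ω => (Y ω, Z ω)) := by
  simp only [cmi, condEnt]
  ring

section product

variable {ι : Type*} [Fintype ι]

lemma isPMF_prod [DecidableEq ι] [Fintype α] {p : α → ℝ} (hp : IsPMF p) :
    IsPMF (fun x : ι → α => ∏ k, p (x k)) := by
  refine ⟨fun x => prod_nonneg fun k _ => hp.1 _, ?_⟩
  rw [← Fintype.prod_sum (fun (_ : ι) => p)]
  simp [hp.2]

lemma distr_prod [DecidableEq ι] [Fintype Ω] [DecidableEq α] (μ : Ω → ℝ) (X : Ω → α)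
    (b : ι → α) :
    distr (fun x : ι → Ω => ∏ k, μ (x k)) (fun x k => X (x k)) b = ∏ k, distr μ X (b k) := by
  simp only [distr]
  rw [Fintype.prod_sum (fun k ω => if X ω = b k then μ ω else 0)]
  refine sum_congr rfl fun x _ => ?_
  rw [Fintype.prod_ite_zero]
  simp only [funext_iff]

lemma mulLogb_prod (f : ι → ℝ) :
    mulLogb (∏ k, f k) = ∑ k, (∏ j, f j) * Real.logb 2 (f k) := by
  rw [mulLogb, ← mul_sum]
  rcases eq_or_ne (∏ k, f k) 0 with h | h
  · simp [h]
  · rw [Real.logb_prod _ _ fun k hk => prod_ne_zero_iff.1 h k hk]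

lemma entFun_prod [DecidableEq ι] [Fintype α] {p : α → ℝ} (hp : ∑ a, p a = 1) :
    entFun (fun x : ι → α => ∏ k, p (x k)) = Fintype.card ι * entFun p := by
  have h : ∀ k : ι, ∑ x : ι → α, (∏ j, p (x j)) * Real.logb 2 (p (x k)) =
      ∑ a, mulLogb (p a) := by
    intro k
    have h1 : ∀ x : ι → α, (∏ j, p (x j)) * Real.logb 2 (p (x k)) =
        ∏ j, (if j = k then mulLogb (p (x j)) else p (x j)) := by
      intro x
      rw [← mul_prod_erase univ (fun j => p (x j)) (mem_univ k),
        ← mul_prod_erase univ (fun j => if j = k then _ else _) (mem_univ k), if_pos rfl,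
        prod_congr rfl fun j hj => if_neg (ne_of_mem_erase hj), mulLogb]
      ring
    simp only [h1]
    rw [← Fintype.prod_sum (fun j a => if j = k then mulLogb (p a) else p a),
      prod_eq_single k]
    · simp
    · intro j _ hj
      simp [hj, hp]
    · simp
  simp only [entFun_eq, mulLogb_prod]
  rw [sum_comm]
  simp [h]

lemma H_prod [DecidableEq ι] [Fintype Ω] [Fintype α] [DecidableEq α] {μ : Ω → ℝ}
    (hμ : IsPMF μ) (X : Ω → α) :
    H (fun x : ι → Ω => ∏ k, μ (x k)) (fun x k => X (x k)) = Fintype.card ι * H μ X := by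
  rw [H, funext (distr_prod μ X), entFun_prod (isPMF_distr hμ X).2, H]

lemma H_prod_pair [DecidableEq ι] [Fintype Ω] [Fintype α] [DecidableEq α] [Fintype β]
    [DecidableEq β] {μ : Ω → ℝ} (hμ : IsPMF μ) (X : Ω → α) (Y : Ω → β) :
    H (fun x : ι → Ω => ∏ k, μ (x k)) (fun x => (fun k => X (x k), fun k => Y (x k))) =
      Fintype.card ι * H μ (fun ω => (X ω, Y ω)) := by
  rw [← H_prod hμ (fun ω => (X ω, Y ω))]
  exact H_equiv_comp (fun x : ι → Ω => ∏ k, μ (x k)) (fun x k => (X (x k), Y (x k)))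
    (Equiv.arrowProdEquivProdArrow ι (fun _ => α) (fun _ => β))

lemma H_prod_triple [DecidableEq ι] [Fintype Ω] [Fintype α] [DecidableEq α] [Fintype β]
    [DecidableEq β] [Fintype γ] [DecidableEq γ] {μ : Ω → ℝ} (hμ : IsPMF μ) (X : Ω → α)
    (Y : Ω → β) (Z : Ω → γ) :
    H (fun x : ι → Ω => ∏ k, μ (x k))
        (fun x => (fun k => X (x k), fun k => Y (x k), fun k => Z (x k))) =
      Fintype.card ι * H μ (fun ω => (X ω, Y ω, Z ω)) := by
  rw [← H_prod_pair hμ X (fun ω => (Y ω, Z ω))]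
  exact H_equiv_comp (fun x : ι → Ω => ∏ k, μ (x k))
    (fun x => (fun k => X (x k), fun k => (Y (x k), Z (x k))))
    ((Equiv.refl (ι → α)).prodCongr
      (Equiv.arrowProdEquivProdArrow ι (fun _ => β) (fun _ => γ)))

/-- Conditional mutual information is additive over i.i.d. copies. -/
lemma cmi_prod [DecidableEq ι] [Fintype Ω] [Fintype α] [DecidableEq α] [Fintype β]
    [DecidableEq β] [Fintype γ] [DecidableEq γ] {μ : Ω → ℝ} (hμ : IsPMF μ) (X : Ω → α)
    (Y : Ω → β) (Z : Ω → γ) :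
    cmi (fun x : ι → Ω => ∏ k, μ (x k)) (fun x k => X (x k)) (fun x k => Y (x k))
      (fun x k => Z (x k)) = Fintype.card ι * cmi μ X Y Z := by
  simp only [cmi]
  rw [H_prod_pair hμ, H_prod_pair hμ, H_prod_triple hμ, H_prod hμ]
  ring

end product

lemma l1dist_comm [Fintype α] (p q : α → ℝ) : l1dist p q = l1dist q p := by
  simp only [l1dist, abs_sub_comm]

lemma cmi_le_cmi_add [Fintype Ω] [Fintype α] [Fintype β] [Fintype γ]
    [DecidableEq α] [DecidableEq β] [DecidableEq γ] {μ ν : Ω → ℝ} (hμ : IsPMF μ)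
    (hν : IsPMF ν) {ε : ℝ} (h : l1dist μ ν ≤ ε) (X : Ω → α) (Y : Ω → β) (Z : Ω → γ) :
    cmi μ X Y Z ≤ cmi ν X Y Z + ε * Real.logb 2 (Fintype.card α) + 2 * mixGap 1 (ε / 2) := by
  have h1 := condEnt_le_condEnt_add hμ hν h X Z
  have h2 := condEnt_le_condEnt_add hν hμ (l1dist_comm μ ν ▸ h) X (fun ω => (Y ω, Z ω))
  rw [cmi_eq_condEnt_sub, cmi_eq_condEnt_sub]
  linarith

lemma two_mul_mixGap_one_le {ε : ℝ} (hε : 0 < ε) (hε' : ε ≤ 1 / 2) :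
    2 * mixGap 1 (ε / 2) ≤ 3 * (-(ε * Real.logb 2 ε)) + 2 * ε := by
  have hlog2 : 0.69 < Real.log 2 := lt_trans (by norm_num) Real.log_two_gt_d9
  have h1 : Real.logb 2 (1 + ε / 2) ≤ ε / 2 / 0.69 := by
    rw [Real.logb, div_le_div_iff₀ (by linarith) (by norm_num)]
    have h := Real.log_le_sub_one_of_pos (show 0 < 1 + ε / 2 by linarith)
    nlinarith
  have h2 : Real.logb 2 (ε / 2) = Real.logb 2 ε - 1 := by
    rw [Real.logb_div hε.ne' two_ne_zero, Real.logb_self_eq_one one_lt_two]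
  have h3 : Real.logb 2 ε ≤ -1 := by
    have h := Real.logb_le_logb_of_le one_lt_two hε hε'
    rwa [one_div, Real.logb_inv, Real.logb_self_eq_one one_lt_two] at h
  have h4 : ε * Real.logb 2 ε ≤ ε * -1 := mul_le_mul_of_nonneg_left h3 hε.le
  have h5 := mul_le_mul_of_nonneg_left h1 (show 0 ≤ 1 + ε / 2 by linarith)
  have h6 : (1 + ε / 2) * (ε / 2 / 0.69) ≤ 1.25 * (ε / 2 / 0.69) :=
    mul_le_mul_of_nonneg_right (by linarith) (by positivity)
  simp only [mixGap, mulLogb_one]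
  simp only [mulLogb, h2]
  norm_num at h5 h6 ⊢
  linarith

/-- continuity of the conditional mutual information rate under total
variation. Fix a pmf `q(x¹,x²,y¹,y²)`, let `0 < ε ≤ 1/2`, `n ≥ 1`, and let `P` be a pmf
on `(𝒳¹×𝒳²×𝒴¹×𝒴²)ⁿ` with `‖P − q^{⊗n}‖₁ ≤ ε`. Then
`(1/n) I_P(Y¹_{1:n}; Y²_{1:n} | X¹_{1:n}, X²_{1:n}) ≥ I_q(Y¹; Y² | X¹, X²) − 3 κ(ε)`,
where `κ(ε) = −ε log₂(ε / (|𝒳¹||𝒳²||𝒴¹||𝒴²|))`. -/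
theorem cmi_rate_continuity
    {𝒳₁ 𝒳₂ 𝒴₁ 𝒴₂ : Type}
    [Fintype 𝒳₁] [DecidableEq 𝒳₁] [Fintype 𝒳₂] [DecidableEq 𝒳₂]
    [Fintype 𝒴₁] [DecidableEq 𝒴₁] [Fintype 𝒴₂] [DecidableEq 𝒴₂]
    (q : 𝒳₁ × 𝒳₂ × 𝒴₁ × 𝒴₂ → ℝ) (hq : IsPMF q)
    (ε : ℝ) (hε : 0 < ε) (hε' : ε ≤ 1 / 2)
    (n : ℕ) (hn : 1 ≤ n)
    (P : (Fin n → 𝒳₁ × 𝒳₂ × 𝒴₁ × 𝒴₂) → ℝ) (hP : IsPMF P)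
    (hclose : l1dist P (fun a => ∏ k, q (a k)) ≤ ε) :
    (1 / (n : ℝ)) *
        cmi P (fun a => fun k => (a k).2.2.1) (fun a => fun k => (a k).2.2.2)
          (fun a => fun k => ((a k).1, (a k).2.1)) ≥
      cmi q (fun a => a.2.2.1) (fun a => a.2.2.2) (fun a => (a.1, a.2.1))
        - 3 * (-(ε * Real.logb 2 (ε /
            ((Fintype.card 𝒳₁ * Fintype.card 𝒳₂ * Fintype.card 𝒴₁ *
              Fintype.card 𝒴₂ : ℕ) : ℝ)))) := by
  have hnpos : (0 : ℝ) < n := by exact_mod_cast hn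
  obtain ⟨⟨x₁, x₂, y₁, y₂⟩⟩ : Nonempty (𝒳₁ × 𝒳₂ × 𝒴₁ × 𝒴₂) := by
    by_contra hne
    rw [not_nonempty_iff] at hne
    simpa using hq.2
  have hx₁ : 0 < Fintype.card 𝒳₁ := Fintype.card_pos_iff.2 ⟨x₁⟩
  have hx₂ : 0 < Fintype.card 𝒳₂ := Fintype.card_pos_iff.2 ⟨x₂⟩
  have hy₁ : 0 < Fintype.card 𝒴₁ := Fintype.card_pos_iff.2 ⟨y₁⟩
  have hy₂ : 0 < Fintype.card 𝒴₂ := Fintype.card_pos_iff.2 ⟨y₂⟩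
  set N := Fintype.card 𝒳₁ * Fintype.card 𝒳₂ * Fintype.card 𝒴₁ * Fintype.card 𝒴₂ with hN
  have hyN : Fintype.card 𝒴₁ ≤ N := by
    rw [hN, show Fintype.card 𝒳₁ * Fintype.card 𝒳₂ * Fintype.card 𝒴₁ * Fintype.card 𝒴₂ =
      Fintype.card 𝒴₁ * (Fintype.card 𝒳₁ * Fintype.card 𝒳₂ * Fintype.card 𝒴₂) by ring]
    exact Nat.le_mul_of_pos_right _ (by positivity)
  have hlogN : Real.logb 2 (Fintype.card 𝒴₁) ≤ Real.logb 2 N :=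
    Real.logb_le_logb_of_le one_lt_two (by exact_mod_cast hy₁) (by exact_mod_cast hyN)
  have hNpos : (0 : ℝ) < N := by exact_mod_cast hy₁.trans_le hyN
  rw [Real.logb_div hε.ne' hNpos.ne']
  rcases (Nat.succ_le_of_lt hy₁).eq_or_lt with h1 | h2
  · have hcard : Fintype.card (Fin n → 𝒴₁) = 1 := by simp [← h1]
    rw [cmi_eq_condEnt_sub, cmi_eq_condEnt_sub,
      condEnt_eq_zero_of_card_eq_one hP.1 hcard, condEnt_eq_zero_of_card_eq_one hP.1 hcard,
      condEnt_eq_zero_of_card_eq_one hq.1 h1.symm, condEnt_eq_zero_of_card_eq_one hq.1 h1.symm]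
    have h3 : Real.logb 2 ε ≤ 0 := Real.logb_nonpos one_lt_two hε.le (by linarith)
    have h4 : 0 ≤ Real.logb 2 (N : ℝ) :=
      (by simp [← h1] : (0 : ℝ) = Real.logb 2 (Fintype.card 𝒴₁)).trans_le hlogN
    have h5 := mul_nonneg hε.le (show 0 ≤ -(Real.logb 2 ε - Real.logb 2 (N : ℝ)) by linarith)
    linarith
  · have hlogY : 1 ≤ Real.logb 2 (Fintype.card 𝒴₁) := by
      have h := Real.logb_le_logb_of_le one_lt_two two_pos
        (show (2 : ℝ) ≤ Fintype.card 𝒴₁ by exact_mod_cast h2)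
      rwa [Real.logb_self_eq_one one_lt_two] at h
    have hdiff := cmi_le_cmi_add (isPMF_prod hq) hP ((l1dist_comm _ _).trans_le hclose)
      (fun a k => (a k).2.2.1) (fun a k => (a k).2.2.2) (fun a k => ((a k).1, (a k).2.1))
    rw [cmi_prod hq (fun a => a.2.2.1) (fun a => a.2.2.2) (fun a => (a.1, a.2.1))] at hdiff
    simp only [Fintype.card_fin, Fintype.card_fun, Nat.cast_pow, Real.logb_pow] at hdiff
    have hgap0 : 0 ≤ mixGap 1 (ε / 2) := mixGap_nonneg zero_le_one (by positivity)
    have hgapn : 2 * mixGap 1 (ε / 2) ≤ n * (2 * mixGap 1 (ε / 2)) :=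
      le_mul_of_one_le_left (by positivity) (by exact_mod_cast hn)
    have hgap := two_mul_mixGap_one_le hε hε'
    have hεY := mul_le_mul_of_nonneg_left hlogY hε.le
    have hεN := mul_le_mul_of_nonneg_left hlogN hε.le
    rw [ge_iff_le, one_div_mul_eq_div, le_div_iff₀ hnpos]
    have hrate := mul_le_mul_of_nonneg_left (show ε * Real.logb 2 (Fintype.card 𝒴₁) +
      2 * mixGap 1 (ε / 2) ≤ 3 * (-(ε * (Real.logb 2 ε - Real.logb 2 (N : ℝ)))) by linarith)
      hnpos.le
    linarith

end Coord
end
end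

section
/- Cuff's soft-covering lemma: For a pmf p(f, v) on a product of finite sets and each n, let 𝒞(n) = {F_{1:n}(t)}_{t=1}^{2^{nR}} be a codebook of sequences drawn independently, each with distribution Π_{k=1}^n p_F(f_k). For a fixed codebook define Q(v_{1:n}) = 2^{-nR} Σ_{t=1}^{2^{nR}} Π_{k=1}^n p_{V|F}(v_k | F_k(t)). If R > I(V; F), then lim_{n→∞} E‖Q(v_{1:n}) − Π_{k=1}^n p_V(v_k)‖₁ = 0, where the expectation is over the randomly constructed codebooks 𝒞(n). -/
open scoped BigOperators
open Finset

noncomputable section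

namespace Coord

variable {Ω α β γ : Type*}

section Aux

variable {ι X V : Type*} [Fintype ι] [DecidableEq ι] [Fintype X] [Fintype V]

lemma sum_prod_pi (f : ι → X → ℝ) : ∑ x : ι → X, ∏ i, f i (x i) = ∏ i, ∑ a, f i a := by
  rw [Finset.prod_univ_sum, Fintype.piFinset_univ]

lemma expect_one (P : X → ℝ) (hP : ∑ x, P x = 1) (g : X → ℝ) (t : ι) :
    ∑ D : ι → X, (∏ i, P (D i)) * g (D t) = ∑ x, P x * g x := by
  have h := sum_prod_pi (ι := ι) (fun i x => P x * (if i = t then g x else 1))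
  simp only [Finset.prod_mul_distrib, Finset.prod_ite_eq', Finset.mem_univ, if_true] at h
  rw [h, Finset.prod_eq_single t]
  · simp
  · intro b _ hb
    simp [hb, hP]
  · simp

lemma expect_two (P : X → ℝ) (hP : ∑ x, P x = 1) (g h : X → ℝ) {t u : ι} (htu : t ≠ u) :
    ∑ D : ι → X, (∏ i, P (D i)) * (g (D t) * h (D u))
      = (∑ x, P x * g x) * ∑ x, P x * h x := by
  have key := sum_prod_pi (ι := ι)
    (fun i x => P x * ((if i = t then g x else 1) * (if i = u then h x else 1)))
  simp only [Finset.prod_mul_distrib, Finset.prod_ite_eq', Finset.mem_univ, if_true] at key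
  rw [key, ← Finset.prod_subset (Finset.subset_univ {t, u}), Finset.prod_pair htu]
  · simp [htu, htu.symm]
  · intro b _ hb
    simp only [Finset.mem_insert, Finset.mem_singleton, not_or] at hb
    simp [hb.1, hb.2, hP]

/-- Second moment of a sum of centred i.i.d. variables. -/
lemma expect_sum_sq (P : X → ℝ) (hP : ∑ x, P x = 1) (h : X → ℝ) (h0 : ∑ x, P x * h x = 0) :
    ∑ D : ι → X, (∏ i, P (D i)) * (∑ t, h (D t)) ^ 2
      = Fintype.card ι * ∑ x, P x * h x ^ 2 := by
  have e : ∀ t : ι, ∑ u : ι, ∑ D : ι → X, (∏ i, P (D i)) * (h (D t) * h (D u))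
      = ∑ x, P x * h x ^ 2 := by
    intro t
    rw [Finset.sum_eq_single t]
    · simp_rw [← sq]
      exact expect_one P hP (fun x => h x ^ 2) t
    · intro u _ hu
      rw [expect_two P hP h h hu.symm, h0, zero_mul]
    · simp
  simp_rw [sq (∑ t, h _), Finset.sum_mul_sum, Finset.mul_sum]
  rw [Finset.sum_comm]
  simp_rw [Finset.sum_comm (s := (Finset.univ : Finset (ι → X)))]
  simp only [← Finset.mul_sum] at e ⊢
  simp_rw [e]
  simp

lemma sum_mul_abs_le_sqrt (w z : X → ℝ) (hw : ∀ x, 0 ≤ w x) (hw1 : ∑ x, w x = 1) :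
    ∑ x, w x * |z x| ≤ √(∑ x, w x * z x ^ 2) := by
  apply Real.le_sqrt_of_sq_le
  have := Finset.sum_sq_le_sum_mul_sum_of_sq_le_mul (Finset.univ : Finset X)
    (r := fun x => w x * |z x|) (f := w) (g := fun x => w x * z x ^ 2)
    (fun x _ => hw x) (fun x _ => mul_nonneg (hw x) (sq_nonneg _))
    (fun x _ => by rw [mul_pow, sq_abs]; exact le_of_eq (by ring))
  simpa [hw1] using this

lemma sum_prod_eq_one (P : X → ℝ) (hP : ∑ x, P x = 1) :
    ∑ D : ι → X, ∏ i, P (D i) = 1 := by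
  rw [sum_prod_pi (fun _ => P)]
  simp [hP]

/-- Mean absolute deviation of an empirical mean of nonnegative i.i.d. variables,
after truncation at level `τ` times the mean. -/
lemma expect_abs_mean_sub_le [Nonempty ι] (P : X → ℝ) (hP0 : ∀ x, 0 ≤ P x) (hP : ∑ x, P x = 1)
    (w : X → ℝ) (hw : ∀ x, 0 ≤ w x) (q τ : ℝ) (hq : q = ∑ x, P x * w x) (hτ : 0 ≤ τ) :
    ∑ D : ι → X, (∏ i, P (D i)) * |(Fintype.card ι : ℝ)⁻¹ * ∑ t, w (D t) - q|
      ≤ q * √(τ / Fintype.card ι) + 2 * ∑ x, if τ * q < w x then P x * w x else 0 := by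
  set M : ℝ := (Fintype.card ι : ℝ) with hM
  have hMpos : 0 < M := by rw [hM]; exact_mod_cast Fintype.card_pos
  set w₂ : X → ℝ := fun x => if τ * q < w x then w x else 0 with hw₂
  set w₁ : X → ℝ := fun x => if τ * q < w x then 0 else w x with hw₁
  have hsplit : ∀ x, w x = w₁ x + w₂ x := fun x => by
    simp only [hw₁, hw₂]; split_ifs <;> simp
  have h1 : ∀ x, 0 ≤ w₁ x := fun x => by simp only [hw₁]; split_ifs <;> simp [hw]
  have h2 : ∀ x, 0 ≤ w₂ x := fun x => by simp only [hw₂]; split_ifs <;> simp [hw]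
  have h1le : ∀ x, w₁ x ≤ w x := fun x => by linarith [hsplit x, h2 x]
  have hq0 : 0 ≤ q := hq ▸ Finset.sum_nonneg fun x _ => mul_nonneg (hP0 x) (hw x)
  have h1τ : ∀ x, w₁ x ≤ τ * q := fun x => by
    simp only [hw₁]; split_ifs with h
    · positivity
    · exact not_lt.1 h
  set m₁ : ℝ := ∑ x, P x * w₁ x with hm₁
  set m₂ : ℝ := ∑ x, P x * w₂ x with hm₂
  have hqm : q = m₁ + m₂ := by
    rw [hq, hm₁, hm₂, ← Finset.sum_add_distrib]
    exact Finset.sum_congr rfl fun x _ => by rw [hsplit x]; ring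
  have hm₂0 : 0 ≤ m₂ := Finset.sum_nonneg fun x _ => mul_nonneg (hP0 x) (h2 x)
  have hm₂' : (∑ x, if τ * q < w x then P x * w x else 0) = m₂ :=
    Finset.sum_congr rfl fun x _ => by simp only [hw₂]; split_ifs <;> simp
  rw [hm₂']
  have hprod : ∀ D : ι → X, 0 ≤ ∏ i, P (D i) := fun D => Finset.prod_nonneg fun i _ => hP0 _
  have hcent : ∑ x, P x * (w₁ x - m₁) = 0 := by
    simp_rw [mul_sub, Finset.sum_sub_distrib, ← Finset.sum_mul, hP]
    simp [hm₁]
  have hvar : ∑ x, P x * (w₁ x - m₁) ^ 2 ≤ τ * q ^ 2 := by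
    have e : ∑ x, P x * (w₁ x - m₁) ^ 2 = ∑ x, P x * w₁ x ^ 2 - m₁ ^ 2 := by
      have : ∀ x, P x * (w₁ x - m₁) ^ 2
          = P x * w₁ x ^ 2 - 2 * m₁ * (P x * w₁ x) + m₁ ^ 2 * P x := fun x => by ring
      simp_rw [this, Finset.sum_add_distrib, Finset.sum_sub_distrib, ← Finset.mul_sum, hP, ← hm₁]
      ring
    have : ∑ x, P x * w₁ x ^ 2 ≤ ∑ x, τ * q * (P x * w x) :=
      Finset.sum_le_sum fun x _ => by
        have := mul_le_mul (h1τ x) (h1le x) (h1 x) (by positivity)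
        nlinarith [mul_le_mul_of_nonneg_left this (hP0 x)]
    rw [← Finset.mul_sum, ← hq] at this
    nlinarith [sq_nonneg m₁]
  have hfirst : ∑ D : ι → X, (∏ i, P (D i)) * |M⁻¹ * ∑ t, (w₁ (D t) - m₁)|
      ≤ q * √(τ / M) := by
    refine (sum_mul_abs_le_sqrt _ _ hprod (sum_prod_eq_one P hP)).trans ?_
    have e : ∑ D : ι → X, (∏ i, P (D i)) * (M⁻¹ * ∑ t, (w₁ (D t) - m₁)) ^ 2
        = M⁻¹ * ∑ x, P x * (w₁ x - m₁) ^ 2 := by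
      have := expect_sum_sq (ι := ι) P hP (fun x => w₁ x - m₁) hcent
      simp_rw [mul_pow, mul_left_comm _ (M⁻¹ ^ 2), ← Finset.mul_sum]
      rw [this, ← hM]
      field_simp
    rw [e]
    calc √(M⁻¹ * ∑ x, P x * (w₁ x - m₁) ^ 2) ≤ √(q ^ 2 * (τ / M)) := by
          apply Real.sqrt_le_sqrt
          rw [show q ^ 2 * (τ / M) = M⁻¹ * (τ * q ^ 2) by ring]
          gcongr
      _ = q * √(τ / M) := by rw [Real.sqrt_mul (sq_nonneg q), Real.sqrt_sq hq0]
  have hsecond : ∑ D : ι → X, (∏ i, P (D i)) * (M⁻¹ * ∑ t, w₂ (D t)) = m₂ := by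
    have e : ∀ D : ι → X, (∏ i, P (D i)) * (M⁻¹ * ∑ t, w₂ (D t))
        = M⁻¹ * ∑ t, (∏ i, P (D i)) * w₂ (D t) := fun D => by
      rw [mul_left_comm, Finset.mul_sum]
    rw [Finset.sum_congr rfl fun D _ => e D, ← Finset.mul_sum, Finset.sum_comm]
    simp_rw [expect_one P hP w₂]
    simp only [Finset.sum_const, Finset.card_univ, nsmul_eq_mul, ← hM, ← hm₂]
    field_simp
  have hpt : ∀ D : ι → X, (∏ i, P (D i)) * |M⁻¹ * ∑ t, w (D t) - q|
      ≤ (∏ i, P (D i)) * |M⁻¹ * ∑ t, (w₁ (D t) - m₁)|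
        + (∏ i, P (D i)) * (M⁻¹ * ∑ t, w₂ (D t)) + (∏ i, P (D i)) * m₂ := by
    intro D
    rw [← mul_add, ← mul_add]
    refine mul_le_mul_of_nonneg_left ?_ (hprod D)
    have hS : 0 ≤ M⁻¹ * ∑ t, w₂ (D t) :=
      mul_nonneg (by positivity) (Finset.sum_nonneg fun t _ => h2 _)
    have e : M⁻¹ * ∑ t, w (D t) - q
        = M⁻¹ * ∑ t, (w₁ (D t) - m₁) + M⁻¹ * ∑ t, w₂ (D t) - m₂ := by
      simp_rw [hsplit, Finset.sum_add_distrib, Finset.sum_sub_distrib]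
      simp only [Finset.sum_const, Finset.card_univ, nsmul_eq_mul, ← hM]
      rw [hqm]
      field_simp
      ring
    rw [e]
    have := abs_sub (M⁻¹ * ∑ t, (w₁ (D t) - m₁) + M⁻¹ * ∑ t, w₂ (D t)) m₂
    have h3 := abs_add_le (M⁻¹ * ∑ t, (w₁ (D t) - m₁)) (M⁻¹ * ∑ t, w₂ (D t))
    rw [abs_of_nonneg hS] at h3
    rw [abs_of_nonneg hm₂0] at this
    linarith
  refine (Finset.sum_le_sum fun D _ => hpt D).trans ?_
  rw [Finset.sum_add_distrib, Finset.sum_add_distrib, hsecond, ← Finset.sum_mul,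
    sum_prod_eq_one P hP]
  linarith

/-- One-shot soft covering bound. -/
lemma expect_l1dist_le [Nonempty ι] (P : X → ℝ) (hP0 : ∀ x, 0 ≤ P x) (hP : ∑ x, P x = 1)
    (W : X → V → ℝ) (hW : ∀ x v, 0 ≤ W x v) (Q : V → ℝ) (hQ : ∀ v, Q v = ∑ x, P x * W x v)
    (hQ1 : ∑ v, Q v = 1) (τ : ℝ) (hτ : 0 ≤ τ) :
    ∑ D : ι → X, (∏ i, P (D i)) *
        l1dist (fun v => (Fintype.card ι : ℝ)⁻¹ * ∑ t, W (D t) v) Q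
      ≤ √(τ / Fintype.card ι)
        + 2 * ∑ x, ∑ v, if τ * Q v < W x v then P x * W x v else 0 := by
  unfold l1dist
  rw [Finset.sum_congr rfl fun D _ => Finset.mul_sum _ _ _, Finset.sum_comm]
  refine (Finset.sum_le_sum fun v _ => expect_abs_mean_sub_le P hP0 hP (fun x => W x v)
    (fun x => hW x v) (Q v) τ (hQ v) hτ).trans_eq ?_
  rw [Finset.sum_add_distrib, ← Finset.sum_mul, hQ1, one_mul, ← Finset.mul_sum, Finset.sum_comm]

/-- If `∑ p (log r) < 0` then some positive exponential moment is less than one. -/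
lemma exists_sum_mul_rpow_lt_one (p r : X → ℝ) (hp : ∑ x, p x = 1) (hr : ∀ x, p x ≠ 0 → 0 < r x)
    (hlog : ∑ x, p x * Real.log (r x) < 0) :
    ∃ s : ℝ, 0 < s ∧ ∑ x, p x * r x ^ s < 1 := by
  have hd : HasDerivAt (fun s : ℝ => ∑ x, p x * r x ^ s) (∑ x, p x * Real.log (r x)) 0 := by
    refine HasDerivAt.fun_sum fun x _ => ?_
    by_cases h : p x = 0
    · simpa [h] using hasDerivAt_const (0 : ℝ) (0 : ℝ)
    · have := ((Real.hasStrictDerivAt_const_rpow (hr x h) 0).hasDerivAt).const_mul (p x)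
      simpa using this
  have hs := hd.tendsto_slope_zero_right
  obtain ⟨s, hs1, hs2⟩ := ((hs.eventually_lt_const hlog).and self_mem_nhdsWithin).exists
  have hs0 : (0 : ℝ) < s := hs2
  refine ⟨s, hs0, ?_⟩
  simp only [zero_add, Real.rpow_zero, mul_one, hp, smul_eq_mul] at hs1
  by_contra! hcon
  have := mul_nonneg (inv_nonneg.2 hs0.le) (sub_nonneg.2 hcon)
  linarith

end Aux

lemma mi_eq_sum_log {𝓕 𝒱 : Type} [Fintype 𝓕] [DecidableEq 𝓕] [Fintype 𝒱] [DecidableEq 𝒱]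
    (p : 𝓕 × 𝒱 → ℝ) (hp : IsPMF p) :
    mi p (fun a => a.2) (fun a => a.1) = ∑ a : 𝓕 × 𝒱,
      p a * Real.logb 2 (p a / (∑ v, p (a.1, v)) / ∑ f, p (f, a.2)) := by
  have hV : ∀ v, distr p (fun a : 𝓕 × 𝒱 => a.2) v = ∑ f, p (f, v) := fun v => by
    simp [distr, Fintype.sum_prod_type]
  have hF : ∀ f, distr p (fun a : 𝓕 × 𝒱 => a.1) f = ∑ v, p (f, v) := fun f => by
    simp only [distr, Fintype.sum_prod_type]
    rw [Finset.sum_comm]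
    simp
  have hVF : ∀ c : 𝒱 × 𝓕, distr p (fun a : 𝓕 × 𝒱 => (a.2, a.1)) c = p (c.2, c.1) := fun c => by
    rw [distr, Finset.sum_eq_single (c.2, c.1)]
    · simp
    · intro b _ hb
      rw [if_neg]
      rintro rfl
      exact hb rfl
    · simp
  simp only [mi, H, entFun, hV, hF, hVF]
  have e1 : ∑ v, (∑ f, p (f, v)) * Real.logb 2 (∑ f, p (f, v))
      = ∑ a : 𝓕 × 𝒱, p a * Real.logb 2 (∑ f, p (f, a.2)) := by
    rw [Fintype.sum_prod_type, Finset.sum_comm]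
    simp_rw [Finset.sum_mul]
  have e2 : ∑ f, (∑ v, p (f, v)) * Real.logb 2 (∑ v, p (f, v))
      = ∑ a : 𝓕 × 𝒱, p a * Real.logb 2 (∑ v, p (a.1, v)) := by
    rw [Fintype.sum_prod_type]
    simp_rw [Finset.sum_mul]
  have e3 : ∑ c : 𝒱 × 𝓕, p (c.2, c.1) * Real.logb 2 (p (c.2, c.1))
      = ∑ a : 𝓕 × 𝒱, p a * Real.logb 2 (p a) :=
    Fintype.sum_equiv (Equiv.prodComm _ _) _ _ fun _ => rfl
  rw [e1, e2, e3, sub_neg_eq_add, ← neg_add, ← Finset.sum_add_distrib, neg_add_eq_sub,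
    ← Finset.sum_sub_distrib]
  refine Finset.sum_congr rfl fun a _ => ?_
  by_cases h : p a = 0
  · simp [h]
  have ha := lt_of_le_of_ne (hp.1 a) (Ne.symm h)
  have h1 : p a ≤ ∑ v, p (a.1, v) :=
    Finset.single_le_sum (f := fun v => p (a.1, v)) (fun v _ => hp.1 _) (Finset.mem_univ a.2)
  have h2 : p a ≤ ∑ f, p (f, a.2) :=
    Finset.single_le_sum (f := fun f => p (f, a.2)) (fun v _ => hp.1 _) (Finset.mem_univ a.1)
  rw [Real.logb_div (div_pos ha (ha.trans_le h1)).ne' (ha.trans_le h2).ne',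
    Real.logb_div ha.ne' (ha.trans_le h1).ne']
  ring

/-- Soft covering bound for memoryless channels, with the probability of exceeding the threshold
`θ ^ n` controlled by an exponential moment. -/
lemma expect_l1dist_pi_le {𝓕 𝒱 ι : Type*} [Fintype 𝓕] [Fintype 𝒱] [Fintype ι] [DecidableEq ι]
    [Nonempty ι] (p : 𝓕 × 𝒱 → ℝ) (hp : IsPMF p) (θ : ℝ) (hθ : 0 < θ) (s : ℝ) (hs : 0 < s)
    (n : ℕ) :
    ∑ D : ι → Fin n → 𝓕, (∏ t, ∏ k, (∑ v, p (D t k, v))) *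
        l1dist
          (fun v : Fin n → 𝒱 => (Fintype.card ι : ℝ)⁻¹ *
            ∑ t, ∏ k, p (D t k, v k) / (∑ v', p (D t k, v')))
          (fun v : Fin n → 𝒱 => ∏ k, (∑ f, p (f, v k)))
      ≤ √(θ ^ n / Fintype.card ι) + 2 * (∑ a : 𝓕 × 𝒱,
          p a * (p a / (∑ v, p (a.1, v)) / (∑ f, p (f, a.2)) / θ) ^ s) ^ n := by
  set pF : 𝓕 → ℝ := fun f => ∑ v, p (f, v) with hpF
  set pV : 𝒱 → ℝ := fun v => ∑ f, p (f, v) with hpV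
  have hF0 : ∀ f, 0 ≤ pF f := fun f => Finset.sum_nonneg fun v _ => hp.1 _
  have hV0 : ∀ v, 0 ≤ pV v := fun v => Finset.sum_nonneg fun f _ => hp.1 _
  have hF1 : ∑ f, pF f = 1 := by rw [← hp.2, Fintype.sum_prod_type]
  have hV1 : ∑ v, pV v = 1 := by rw [← hp.2, Fintype.sum_prod_type, Finset.sum_comm]
  have hle : ∀ f v, p (f, v) ≤ pF f := fun f v =>
    Finset.single_le_sum (f := fun v => p (f, v)) (fun v _ => hp.1 _) (Finset.mem_univ v)
  have hle' : ∀ f v, p (f, v) ≤ pV v := fun f v =>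
    Finset.single_le_sum (f := fun f => p (f, v)) (fun v _ => hp.1 _) (Finset.mem_univ f)
  have hmul : ∀ f v, pF f * (p (f, v) / pF f) = p (f, v) := fun f v => by
    by_cases h : pF f = 0
    · have := le_antisymm (h ▸ hle f v) (hp.1 _)
      simp [h, this]
    · field_simp
  have hPW : ∀ (x : Fin n → 𝓕) (v : Fin n → 𝒱),
      (∏ k, pF (x k)) * ∏ k, p (x k, v k) / pF (x k) = ∏ k, p (x k, v k) := fun x v => by
    rw [← Finset.prod_mul_distrib]
    exact Finset.prod_congr rfl fun k _ => hmul _ _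
  have hQ : ∀ v : Fin n → 𝒱, ∏ k, pV (v k)
      = ∑ x : Fin n → 𝓕, (∏ k, pF (x k)) * ∏ k, p (x k, v k) / pF (x k) := fun v => by
    simp_rw [hPW]
    exact (sum_prod_pi (fun k f => p (f, v k))).symm
  have hW0 : ∀ (x : Fin n → 𝓕) (v : Fin n → 𝒱), 0 ≤ ∏ k, p (x k, v k) / pF (x k) :=
    fun x v => Finset.prod_nonneg fun k _ => div_nonneg (hp.1 _) (hF0 _)
  have hP0 : ∀ x : Fin n → 𝓕, 0 ≤ ∏ k, pF (x k) := fun x => Finset.prod_nonneg fun k _ => hF0 _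
  have key := expect_l1dist_le (ι := ι) (fun x : Fin n → 𝓕 => ∏ k, pF (x k)) hP0
    (sum_prod_eq_one pF hF1) (fun (x : Fin n → 𝓕) (v : Fin n → 𝒱) => ∏ k, p (x k, v k) / pF (x k))
    hW0 (fun v => ∏ k, pV (v k)) hQ (sum_prod_eq_one pV hV1) (θ ^ n) (pow_nonneg hθ.le n)
  refine key.trans ?_
  gcongr
  set g : 𝓕 → 𝒱 → ℝ := fun f v => p (f, v) * (p (f, v) / pF f / pV v / θ) ^ s with hg
  have hsum : (∑ a : 𝓕 × 𝒱, p a * (p a / pF a.1 / pV a.2 / θ) ^ s) ^ n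
      = ∑ x : Fin n → 𝓕, ∑ v : Fin n → 𝒱, ∏ k, g (x k) (v k) := by
    rw [Finset.sum_congr rfl fun (x : Fin n → 𝓕) _ => sum_prod_pi (fun k v => g (x k) v),
      sum_prod_pi (fun _ f => ∑ v, g f v)]
    simp [Fintype.sum_prod_type, hg]
  rw [hsum]
  refine Finset.sum_le_sum fun x _ => Finset.sum_le_sum fun v _ => ?_
  have hr0 : ∀ k, 0 ≤ p (x k, v k) / pF (x k) / pV (v k) / θ := fun k =>
    div_nonneg (div_nonneg (div_nonneg (hp.1 _) (hF0 _)) (hV0 _)) hθ.le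
  have hprod0 : 0 ≤ ∏ k, p (x k, v k) := Finset.prod_nonneg fun k _ => hp.1 _
  have hgprod : ∏ k, g (x k) (v k)
      = (∏ k, p (x k, v k)) * (∏ k, p (x k, v k) / pF (x k) / pV (v k) / θ) ^ s := by
    simp only [hg]
    rw [Finset.prod_mul_distrib, Real.finsetProd_rpow _ _ fun k _ => hr0 k]
  rw [hPW, hgprod]
  split_ifs with h
  · by_cases hz : ∏ k, pV (v k) = 0
    · obtain ⟨k, -, hk⟩ := Finset.prod_eq_zero_iff.1 hz
      have : ∏ k, p (x k, v k) = 0 :=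
        Finset.prod_eq_zero (Finset.mem_univ k) (le_antisymm (hk ▸ hle' _ _) (hp.1 _))
      simp [this]
    · refine le_mul_of_one_le_right hprod0 (Real.one_le_rpow ?_ hs.le)
      have hpos : 0 < ∏ k, pV (v k) :=
        lt_of_le_of_ne (Finset.prod_nonneg fun k _ => hV0 _) (Ne.symm hz)
      rw [Finset.prod_div_distrib, Finset.prod_div_distrib]
      simp only [Finset.prod_const, Finset.card_univ, Fintype.card_fin]
      rw [div_div, one_le_div (by positivity), mul_comm]
      exact h.le
  · exact mul_nonneg hprod0 (Real.rpow_nonneg (Finset.prod_nonneg fun k _ => hr0 k) _)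

/-- Cuff's soft-covering lemma, Lemma 6.1 of Cuff. For a pmf `p(f,v)`
and each `n`, draw a codebook of `⌈2^{nR}⌉` independent codewords, each i.i.d. with the
`F`-marginal `p_F`. For a fixed codebook `D` define
`Q(v_{1:n}) = ⌈2^{nR}⌉⁻¹ Σ_t Π_k p_{V|F}(v_k | D t k)`. If `R > I(V; F)` then the
expected total variation distance `E ‖Q − Π_k p_V(v_k)‖₁` tends to `0` as `n → ∞`.
Coordinates on the sample space of `p`: `a.1 = f`, `a.2 = v`. -/
theorem cuff_soft_covering
    {𝓕 𝒱 : Type} [Fintype 𝓕] [DecidableEq 𝓕] [Fintype 𝒱] [DecidableEq 𝒱]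
    (p : 𝓕 × 𝒱 → ℝ) (hp : IsPMF p) (R : ℝ)
    (hR : R > mi p (fun a => a.2) (fun a => a.1)) :
    Filter.Tendsto (fun n : ℕ =>
      ∑ D : Fin ⌈(2 : ℝ) ^ ((n : ℝ) * R)⌉₊ → Fin n → 𝓕,
        (∏ t, ∏ k, (∑ v, p (D t k, v))) *
          l1dist
            (fun v : Fin n → 𝒱 =>
              ((⌈(2 : ℝ) ^ ((n : ℝ) * R)⌉₊ : ℕ) : ℝ)⁻¹ *
                ∑ t, ∏ k, p (D t k, v k) / (∑ v', p (D t k, v')))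
            (fun v : Fin n → 𝒱 => ∏ k, (∑ f, p (f, v k))))
      Filter.atTop (nhds 0) := by
  set I := mi p (fun a => a.2) (fun a => a.1) with hI
  set θ : ℝ := 2 ^ ((I + R) / 2) with hθdef
  have hθ : 0 < θ := by positivity
  set r : 𝓕 × 𝒱 → ℝ := fun a => p a / (∑ v, p (a.1, v)) / (∑ f, p (f, a.2)) with hr
  have hrpos : ∀ a, p a ≠ 0 → 0 < r a := by
    intro a h
    have ha := lt_of_le_of_ne (hp.1 a) (Ne.symm h)
    have h1 : p a ≤ ∑ v, p (a.1, v) :=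
      Finset.single_le_sum (f := fun v => p (a.1, v)) (fun v _ => hp.1 _) (Finset.mem_univ a.2)
    have h2 : p a ≤ ∑ f, p (f, a.2) :=
      Finset.single_le_sum (f := fun f => p (f, a.2)) (fun v _ => hp.1 _) (Finset.mem_univ a.1)
    exact div_pos (div_pos ha (ha.trans_le h1)) (ha.trans_le h2)
  have hl2 : 0 < Real.log 2 := Real.log_pos one_lt_two
  have hlog : ∑ a, p a * Real.log (r a / θ) < 0 := by
    have e : ∑ a, p a * Real.log (r a / θ) = Real.log 2 * (I - (I + R) / 2) := by
      have hterm : ∀ a, p a * Real.log (r a / θ)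
          = Real.log 2 * (p a * Real.logb 2 (r a)) - Real.log θ * p a := by
        intro a
        by_cases h : p a = 0
        · simp [h]
        · rw [Real.log_div (hrpos a h).ne' hθ.ne', Real.logb]
          field_simp
      simp_rw [hterm, Finset.sum_sub_distrib, ← Finset.mul_sum, hp.2]
      rw [← mi_eq_sum_log p hp, ← hI, hθdef, Real.log_rpow two_pos]
      ring
    rw [e]
    exact mul_neg_of_pos_of_neg hl2 (by linarith)
  obtain ⟨s, hs, hlt⟩ := exists_sum_mul_rpow_lt_one p (fun a => r a / θ) hp.2
    (fun a h => div_pos (hrpos a h) hθ) hlog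
  have hr0 : ∀ a, 0 ≤ r a / θ := fun a => div_nonneg (div_nonneg (div_nonneg (hp.1 _)
    (Finset.sum_nonneg fun _ _ => hp.1 _)) (Finset.sum_nonneg fun _ _ => hp.1 _)) hθ.le
  have hφ0 : 0 ≤ ∑ a, p a * (r a / θ) ^ s :=
    Finset.sum_nonneg fun a _ => mul_nonneg (hp.1 a) (Real.rpow_nonneg (hr0 a) s)
  have hratio : θ / 2 ^ R < 1 := by
    rw [div_lt_one (by positivity), hθdef]
    exact Real.rpow_lt_rpow_of_exponent_lt one_lt_two (by linarith)
  have hlim : Filter.Tendsto (fun n : ℕ => √((θ / 2 ^ R) ^ n)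
      + 2 * (∑ a, p a * (r a / θ) ^ s) ^ n) Filter.atTop (nhds 0) := by
    have h1 := (tendsto_pow_atTop_nhds_zero_of_lt_one (by positivity) hratio).sqrt
    have h2 := (tendsto_pow_atTop_nhds_zero_of_lt_one hφ0 hlt).const_mul 2
    simpa using h1.add h2
  refine squeeze_zero (fun n => ?_) (fun n => ?_) hlim
  · exact Finset.sum_nonneg fun D _ => mul_nonneg
      (Finset.prod_nonneg fun t _ => Finset.prod_nonneg fun k _ =>
        Finset.sum_nonneg fun v _ => hp.1 _)
      (Finset.sum_nonneg fun v _ => abs_nonneg _)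
  · have hMpos : 0 < ⌈(2 : ℝ) ^ ((n : ℝ) * R)⌉₊ := Nat.ceil_pos.2 (by positivity)
    have : Nonempty (Fin ⌈(2 : ℝ) ^ ((n : ℝ) * R)⌉₊) := ⟨⟨0, hMpos⟩⟩
    have key := expect_l1dist_pi_le (ι := Fin ⌈(2 : ℝ) ^ ((n : ℝ) * R)⌉₊) p hp θ hθ s hs n
    rw [Fintype.card_fin] at key
    refine key.trans (add_le_add_left (Real.sqrt_le_sqrt ?_) _)
    rw [div_pow]
    refine div_le_div_of_nonneg_left (by positivity) (by positivity) ?_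
    rw [← Real.rpow_natCast, ← Real.rpow_mul two_pos.le, mul_comm R]
    exact Nat.le_ceil _

end Coord
end
end
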